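/- Let τ > 0. For every policy π with sup_{x,a} ∫ KL(π_{x′} ‖ π̄_{x′}) dP_{x,a}(x′) < ∞, the unique bounded fixed point q^π_τ of the soft Bellman policy-evaluation operator B^π_τ satisfies q^π_τ(x,a) ≤ q*_τ(x,a) for all (x,a) ∈ 𝒳 × 𝒜, where q*_τ is the unique bounded fixed point of the soft Bellman optimality operator B*_τ. -/

import Mathlib

open MeasureTheory ProbabilityTheory ENNReal

/-- Bounded measurable real-valued functions. -/
def BoundedMeasurable {Ω : Type*} [MeasurableSpace Ω] (q : Ω → ℝ) : Prop :=
  Measurable q ∧ ∃ C : ℝ, ∀ p, |q p| ≤ C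

open Classical in
/-- Kullback–Leibler divergence. -/
noncomputable def KL {Ω : Type*} [MeasurableSpace Ω] (μ ν : Measure Ω) : ℝ≥0∞ :=
  if μ ≪ ν ∧ Integrable (llr μ ν) μ then ENNReal.ofReal (∫ x, llr μ ν x ∂μ) else ⊤

/-- The soft value `(V_τ q)(x) = τ log ∫ exp(q(x,a)/τ) dπ̄ₓ(a)`. -/
noncomputable def softV {X A : Type*} [MeasurableSpace X] [MeasurableSpace A]
    (τ : ℝ) (piRef : Kernel X A) (q : X × A → ℝ) (x : X) : ℝ :=
  τ * Real.log (∫ a, Real.exp (q (x, a) / τ) ∂(piRef x))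

/-- The soft Bellman optimality operator. -/
noncomputable def softBellmanOpt {X A : Type*} [MeasurableSpace X] [MeasurableSpace A]
    (τ γ : ℝ) (r : X × A → ℝ) (P : Kernel (X × A) X) (piRef : Kernel X A)
    (q : X × A → ℝ) : X × A → ℝ :=
  fun p => r p + γ * ∫ x', softV τ piRef q x' ∂(P p)

/-- The soft Bellman policy-evaluation operator. -/
noncomputable def softBellmanEval {X A : Type*} [MeasurableSpace X] [MeasurableSpace A]
    (τ γ : ℝ) (r : X × A → ℝ) (P : Kernel (X × A) X) (piRef : Kernel X A)
    (pol : Kernel X A) (q : X × A → ℝ) : X × A → ℝ :=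
  fun p => r p + γ *
    ∫ x', ((∫ a', q (x', a') ∂(pol x')) - τ * (KL (pol x') (piRef x')).toReal) ∂(P p)

open InformationTheory

lemma KL_eq_klDiv {Ω : Type*} [MeasurableSpace Ω] (μ ν : Measure Ω)
    [IsProbabilityMeasure μ] [IsProbabilityMeasure ν] : KL μ ν = klDiv μ ν := by
  by_cases h : μ ≪ ν ∧ Integrable (llr μ ν) μ
  · rw [KL, if_pos h, klDiv_of_ac_of_integrable h.1 h.2]
    simp
  · rw [KL, if_neg h, eq_comm, klDiv_eq_top_iff]
    exact fun h1 h2 => h ⟨h1, h2⟩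

lemma measurable_KL_kernel {X A : Type*} [MeasurableSpace X] [MeasurableSpace A]
    [MeasurableSpace.CountableOrCountablyGenerated X A]
    (κ η : Kernel X A) [IsMarkovKernel κ] [IsMarkovKernel η] :
    Measurable fun x => KL (κ x) (η x) := by
  classical
  have h (x : X) : KL (κ x) (η x) = if κ x ≪ η x then
      ∫⁻ a, ENNReal.ofReal (klFun (κ.rnDeriv η x a).toReal) ∂(η x) else ∞ := by
    rw [KL_eq_klDiv, klDiv_eq_lintegral_klFun]
    congr 1
    refine lintegral_congr_ae ?_
    filter_upwards [Kernel.rnDeriv_eq_rnDeriv_measure (κ := κ) (η := η) (a := x)] with a ha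
    rw [ha]
  simp_rw [h]
  refine Measurable.ite (Kernel.measurableSet_absolutelyContinuous κ η) ?_ measurable_const
  refine Measurable.lintegral_kernel_prod_right (f := fun x a =>
    ENNReal.ofReal (klFun (κ.rnDeriv η x a).toReal)) ?_
  exact (measurable_klFun.comp (Kernel.measurable_rnDeriv κ η).ennreal_toReal).ennreal_ofReal

lemma integrable_of_measurable_of_abs_le {Ω : Type*} [MeasurableSpace Ω] {μ : Measure Ω}
    [IsFiniteMeasure μ] {f : Ω → ℝ} (hf : Measurable f) {C : ℝ} (hC : ∀ x, |f x| ≤ C) :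
    Integrable f μ :=
  Integrable.of_bound hf.aestronglyMeasurable C (ae_of_all _ hC)

lemma integrable_exp_div_of_abs_le {Ω : Type*} [MeasurableSpace Ω] {μ : Measure Ω}
    [IsFiniteMeasure μ] {f : Ω → ℝ} (hf : Measurable f) {C : ℝ} (hC : ∀ x, |f x| ≤ C)
    {τ : ℝ} (hτ : 0 < τ) : Integrable (fun x => Real.exp (f x / τ)) μ := by
  refine integrable_of_measurable_of_abs_le (by fun_prop) (C := Real.exp (C / τ)) fun x => ?_
  rw [Real.abs_exp, Real.exp_le_exp]
  gcongr
  exact (abs_le.1 (hC x)).2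

/-- The Gibbs variational inequality: a KL-penalised expectation is at most a log-partition. -/
lemma integral_sub_mul_KL_le {Ω : Type*} [MeasurableSpace Ω] (μ ν : Measure Ω)
    [IsProbabilityMeasure μ] [IsProbabilityMeasure ν] {f : Ω → ℝ} (hf : Measurable f)
    {C : ℝ} (hC : ∀ x, |f x| ≤ C) {τ : ℝ} (hτ : 0 < τ) (hKL : KL μ ν ≠ ∞) :
    ∫ x, f x ∂μ - τ * (KL μ ν).toReal ≤ τ * Real.log (∫ x, Real.exp (f x / τ) ∂ν) := by
  rw [KL_eq_klDiv] at hKL ⊢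
  obtain ⟨hac, hint⟩ := klDiv_ne_top_iff.1 hKL
  have hexp : Integrable (fun x => Real.exp (f x / τ)) ν := integrable_exp_div_of_abs_le hf hC hτ
  have hfi : Integrable (fun x => f x / τ) μ :=
    (integrable_of_measurable_of_abs_le hf hC).div_const τ
  have : IsProbabilityMeasure (ν.tilted fun x => f x / τ) := isProbabilityMeasure_tilted hexp
  have hgibbs := integral_llr_add_sub_measure_univ_nonneg
    (hac.trans (absolutelyContinuous_tilted hexp)) (integrable_llr_tilted_right hac hfi hint hexp)
  rw [integral_llr_tilted_right hac hfi hexp hint, integral_div] at hgibbs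
  simp only [probReal_univ, add_sub_cancel_right] at hgibbs
  rw [toReal_klDiv_of_measure_eq hac (by simp)]
  have h := mul_nonneg hτ.le hgibbs
  have h' : τ * ((∫ x, f x ∂μ) / τ) = ∫ x, f x ∂μ := mul_div_cancel₀ _ hτ.ne'
  linarith

lemma softV_le_softV_add {X A : Type*} [MeasurableSpace X] [MeasurableSpace A]
    {τ : ℝ} (hτ : 0 < τ) (piRef : Kernel X A) [IsMarkovKernel piRef] {q q' : X × A → ℝ}
    (hq : BoundedMeasurable q) (hq' : BoundedMeasurable q') {c : ℝ}
    (h : ∀ p, q p ≤ q' p + c) (x : X) :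
    softV τ piRef q x ≤ softV τ piRef q' x + c := by
  obtain ⟨hm, C, hC⟩ := hq
  obtain ⟨hm', C', hC'⟩ := hq'
  have hi : Integrable (fun a => Real.exp (q (x, a) / τ)) (piRef x) :=
    integrable_exp_div_of_abs_le (hm.comp measurable_prodMk_left) (fun a => hC (x, a)) hτ
  have hi' : Integrable (fun a => Real.exp (q' (x, a) / τ)) (piRef x) :=
    integrable_exp_div_of_abs_le (hm'.comp measurable_prodMk_left) (fun a => hC' (x, a)) hτ
  have hle : ∫ a, Real.exp (q (x, a) / τ) ∂(piRef x) ≤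
      (∫ a, Real.exp (q' (x, a) / τ) ∂(piRef x)) * Real.exp (c / τ) := by
    rw [← integral_mul_const]
    refine integral_mono hi (hi'.mul_const _) fun a => ?_
    simp only [← Real.exp_add, ← add_div]
    gcongr
    exact h (x, a)
  have hlog := Real.log_le_log (integral_exp_pos hi) hle
  rw [Real.log_mul (integral_exp_pos hi').ne' (Real.exp_pos _).ne', Real.log_exp] at hlog
  calc softV τ piRef q x
      ≤ τ * (Real.log (∫ a, Real.exp (q' (x, a) / τ) ∂(piRef x)) + c / τ) :=
        mul_le_mul_of_nonneg_left hlog hτ.le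
    _ = softV τ piRef q' x + c := by rw [softV, mul_add, mul_div_cancel₀ _ hτ.ne']

lemma BoundedMeasurable.softV {X A : Type*} [MeasurableSpace X] [MeasurableSpace A]
    {τ : ℝ} (hτ : 0 < τ) (piRef : Kernel X A) [IsMarkovKernel piRef] {q : X × A → ℝ}
    (hq : BoundedMeasurable q) : BoundedMeasurable (softV τ piRef q) := by
  have hzero (x : X) : _root_.softV τ piRef (fun _ => 0) x = 0 := by simp [_root_.softV]
  have hbzero : BoundedMeasurable fun _ : X × A => (0 : ℝ) := ⟨measurable_const, 0, by simp⟩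
  obtain ⟨C, hC⟩ := hq.2
  refine ⟨?_, C, fun x => abs_le.2 ⟨?_, ?_⟩⟩
  · have hm : Measurable fun p => Real.exp (q p / τ) := (hq.1.div_const τ).exp
    exact hm.stronglyMeasurable.integral_kernel_prod_right'.measurable.log.const_mul τ
  · have := softV_le_softV_add hτ piRef hbzero hq (c := C)
      (fun p => by linarith [(abs_le.1 (hC p)).1]) x
    linarith [hzero x]
  · have := softV_le_softV_add hτ piRef hq hbzero (c := C)
      (fun p => by linarith [(abs_le.1 (hC p)).2]) x
    linarith [hzero x]

lemma softBellmanEval_le_softBellmanOpt {X A : Type*} [MeasurableSpace X] [MeasurableSpace A]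
    [MeasurableSpace.CountableOrCountablyGenerated X A] {τ γ : ℝ} (hτ : 0 < τ) (hγ : 0 ≤ γ)
    (r : X × A → ℝ) (P : Kernel (X × A) X) [IsMarkovKernel P]
    (piRef pol : Kernel X A) [IsMarkovKernel piRef] [IsMarkovKernel pol] {q : X × A → ℝ}
    (hq : BoundedMeasurable q) {p : X × A}
    (hKL : ∫⁻ x', KL (pol x') (piRef x') ∂(P p) ≠ ∞) :
    softBellmanEval τ γ r P piRef pol q p ≤ softBellmanOpt τ γ r P piRef q p := by
  have hV := hq.softV hτ piRef
  obtain ⟨hm, C, hC⟩ := hq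
  obtain ⟨hVm, D, hD⟩ := hV
  have hKLm := measurable_KL_kernel pol piRef
  have hint : Integrable (fun x' => ∫ a', q (x', a') ∂(pol x')) (P p) := by
    refine integrable_of_measurable_of_abs_le (C := C)
      hm.stronglyMeasurable.integral_kernel_prod_right'.measurable fun x => ?_
    simpa using norm_integral_le_of_norm_le_const (μ := pol x)
      (f := fun a => q (x, a)) (ae_of_all _ fun a => hC (x, a))
  unfold softBellmanEval softBellmanOpt
  refine add_le_add_right (mul_le_mul_of_nonneg_left ?_ hγ) _
  refine integral_mono_ae
    (hint.sub ((integrable_toReal_of_lintegral_ne_top hKLm.aemeasurable hKL).const_mul τ))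
    (integrable_of_measurable_of_abs_le hVm hD) ?_
  filter_upwards [ae_lt_top hKLm hKL] with x hx
  exact integral_sub_mul_KL_le (pol x) (piRef x) (hm.comp measurable_prodMk_left)
    (fun a => hC (x, a)) hτ hx.ne

lemma softBellmanOpt_le_add {X A : Type*} [MeasurableSpace X] [MeasurableSpace A]
    {τ γ : ℝ} (hτ : 0 < τ) (hγ : 0 ≤ γ) (r : X × A → ℝ) (P : Kernel (X × A) X) [IsMarkovKernel P]
    (piRef : Kernel X A) [IsMarkovKernel piRef] {q q' : X × A → ℝ}
    (hq : BoundedMeasurable q) (hq' : BoundedMeasurable q') {c : ℝ}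
    (h : ∀ p, q p ≤ q' p + c) (p : X × A) :
    softBellmanOpt τ γ r P piRef q p ≤ softBellmanOpt τ γ r P piRef q' p + γ * c := by
  obtain ⟨hm, D, hD⟩ := hq.softV hτ piRef
  obtain ⟨hm', D', hD'⟩ := hq'.softV hτ piRef
  have hi' : Integrable (softV τ piRef q') (P p) := integrable_of_measurable_of_abs_le hm' hD'
  have hle : ∫ x', softV τ piRef q x' ∂(P p) ≤ (∫ x', softV τ piRef q' x' ∂(P p)) + c := by
    calc ∫ x', softV τ piRef q x' ∂(P p) ≤ ∫ x', (softV τ piRef q' x' + c) ∂(P p) :=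
          integral_mono (integrable_of_measurable_of_abs_le hm hD)
            (hi'.add (integrable_const c)) (softV_le_softV_add hτ piRef hq hq' h)
      _ = _ := by simp [integral_add hi' (integrable_const c)]
  have := mul_le_mul_of_nonneg_left hle hγ
  unfold softBellmanOpt
  linarith

/-- For every admissible policy `π`, the bounded fixed point `q^π_τ` of `B^π_τ` is dominated by
the bounded fixed point `q*_τ` of `B*_τ`: `q^π_τ(x,a) ≤ q*_τ(x,a)` for all `(x,a)`. -/
theorem qPol_le_qStar
    {X A : Type*} [MeasurableSpace X] [MeasurableSpace A]
    [StandardBorelSpace X] [StandardBorelSpace A]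
    (P : Kernel (X × A) X) [IsMarkovKernel P]
    (piRef : Kernel X A) [IsMarkovKernel piRef]
    (r : X × A → ℝ) (hr : BoundedMeasurable r)
    (γ : ℝ) (hγ0 : 0 < γ) (hγ1 : γ < 1)
    (τ : ℝ) (hτ : 0 < τ)
    (pol : Kernel X A) [IsMarkovKernel pol]
    (hKL : ∃ C : ℝ≥0∞, C ≠ ⊤ ∧
      ∀ p : X × A, ∫⁻ x', KL (pol x') (piRef x') ∂(P p) ≤ C)
    (qstar : X × A → ℝ) (hqstar : BoundedMeasurable qstar)
    (hqstarFix : softBellmanOpt τ γ r P piRef qstar = qstar)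
    (qpol : X × A → ℝ) (hqpol : BoundedMeasurable qpol)
    (hqpolFix : softBellmanEval τ γ r P piRef pol qpol = qpol) :
    ∀ p : X × A, qpol p ≤ qstar p := by
  obtain ⟨K, hK, hKle⟩ := hKL
  intro p₀
  have : Nonempty (X × A) := ⟨p₀⟩
  have hbdd : BddAbove (Set.range fun p => qpol p - qstar p) := by
    obtain ⟨-, C, hC⟩ := hqpol
    obtain ⟨-, D, hD⟩ := hqstar
    refine ⟨C + D, ?_⟩
    rintro _ ⟨p, rfl⟩
    linarith [(abs_le.1 (hC p)).2, (abs_le.1 (hD p)).1]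
  set c := ⨆ p, (qpol p - qstar p)
  have hle (p : X × A) : qpol p ≤ qstar p + c := by linarith [le_ciSup hbdd p]
  have hstep (p : X × A) : qpol p - qstar p ≤ γ * c := by
    have h1 := softBellmanEval_le_softBellmanOpt hτ hγ0.le r P piRef pol hqpol
      (ne_top_of_le_ne_top hK (hKle p))
    have h2 := softBellmanOpt_le_add hτ hγ0.le r P piRef hqpol hqstar hle p
    rw [hqpolFix] at h1
    rw [hqstarFix] at h2
    linarith
  have hc : c ≤ γ * c := ciSup_le hstep
  have hc0 : c ≤ 0 := by nlinarith
  linarith [hle p₀]
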